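/- Let K be an algebraic closure of the field 𝔽₅ = ℤ/5ℤ, and let α := 1 ∈ K (which satisfies 7α³ + 7α + 1 = 0 in K). Let S_α := P − U_{a₁,…,a₅} over K with a₁ := −(12/7)α² − (384/49)α − 8/7, a₂ := −(32/7)α² + (24/49)α − 4, a₃ := −4α² + (24/49)α − 4, a₄ := −(8/7)α² + (8/49)α − 8/7, a₅ := 49α² − 7α + 50 (all fractions interpreted via the inverses of 7 and 49 in K). Then the surface {S_α = 0} in ℙ³(K) has exactly 100 singular points, and every one of them is a node. -/

import Mathlib

open MvPolynomial

instance : Fact (Nat.Prime 5) := ⟨by norm_num⟩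

/-- `K`, an algebraic closure of the field `𝔽₅ = ℤ/5ℤ`. -/
abbrev K5 : Type _ := AlgebraicClosure (ZMod 5)

/-- The septic `P(x,y,z,w)` over a commutative ring
(variables `X 0 = x, X 1 = y, X 2 = z, X 3 = w`). -/
noncomputable def Psept (K : Type*) [CommRing K] : MvPolynomial (Fin 4) K :=
  X 0 * ((X 0) ^ 6 - 21 * (X 0) ^ 4 * (X 1) ^ 2 + 35 * (X 0) ^ 2 * (X 1) ^ 4
      - 7 * (X 1) ^ 6)
    + 7 * X 2 * (((X 0) ^ 2 + (X 1) ^ 2) ^ 3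
        - 8 * (X 2) ^ 2 * ((X 0) ^ 2 + (X 1) ^ 2) ^ 2
        + 16 * (X 2) ^ 4 * ((X 0) ^ 2 + (X 1) ^ 2))
    - 64 * (X 2) ^ 7

/-- `U_{a₁,…,a₅}(x,y,z,w) = (z + a₅w)(a₁z³ + a₂z²w + a₃zw² + a₄w³ + (z+w)(x²+y²))²`. -/
noncomputable def Usept {K : Type*} [CommRing K] (a₁ a₂ a₃ a₄ a₅ : K) :
    MvPolynomial (Fin 4) K :=
  (X 2 + C a₅ * X 3) *
    (C a₁ * (X 2) ^ 3 + C a₂ * (X 2) ^ 2 * X 3 + C a₃ * X 2 * (X 3) ^ 2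
        + C a₄ * (X 3) ^ 3 + (X 2 + X 3) * ((X 0) ^ 2 + (X 1) ^ 2)) ^ 2

/-- All partial derivatives of `F` vanish at `v`. -/
def VanishingJacobianAt {K : Type*} [CommRing K]
    (F : MvPolynomial (Fin 4) K) (v : Fin 4 → K) : Prop :=
  ∀ i, eval v (pderiv i F) = 0

/-- The Hessian matrix `(∂²F/∂xᵢ∂xⱼ)(v)`. -/
noncomputable def hessianAt {K : Type*} [CommRing K]
    (F : MvPolynomial (Fin 4) K) (v : Fin 4 → K) : Matrix (Fin 4) (Fin 4) K :=
  Matrix.of fun i j => eval v (pderiv i (pderiv j F))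

/-- A point of ℙ³(K) is a singular point of `{F = 0}` if it is represented by a
nonzero vector at which all four partial derivatives of `F` vanish. -/
def IsSingularPoint {K : Type*} [Field K] (F : MvPolynomial (Fin 4) K)
    (p : Projectivization K (Fin 4 → K)) : Prop :=
  ∃ v : Fin 4 → K, ∃ hv : v ≠ 0, Projectivization.mk K v hv = p ∧
    VanishingJacobianAt F v

/-- A point of ℙ³(K) is a node of `{F = 0}` if it is represented by a nonzero
vector at which all partial derivatives of `F` vanish and the 4×4 Hessian
matrix has rank 3. -/
def IsNode {K : Type*} [Field K] (F : MvPolynomial (Fin 4) K)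
    (p : Projectivization K (Fin 4 → K)) : Prop :=
  ∃ v : Fin 4 → K, ∃ hv : v ≠ 0, Projectivization.mk K v hv = p ∧
    VanishingJacobianAt F v ∧ (hessianAt F v).rank = 3


section gen
variable {K : Type*} [Field K]

/-- The specialised surface. -/
noncomputable def S5 (K : Type*) [Field K] : MvPolynomial (Fin 4) K :=
  Psept K - Usept (-1) 1 3 (-1) 2

/-- The cubic `B`. -/
def fB (r z w : K) : K := -z^3+z^2*w+3*z*w^2-w^3+(z+w)*r
def fBz (r z w : K) : K := -3*z^2+2*z*w+3*w^2+r
def fGr (r z w : K) : K := z*r^2-2*z^3*r+2*z^5-2*(z+2*w)*(z+w)*fB r z w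
def fGz (r z w : K) : K := 2*r^3-3*z^2*r^2+2*z^6-fB r z w^2-2*(z+2*w)*fB r z w*fBz r z w
def fC (r z w : K) : K := (2*z+3*w)*r+w*(4*z^2+2*z*w+3*w^2)
def fGrr (r z w : K) : K := 2*z*r-2*z^3-2*(z+2*w)*(z+w)^2
def fGrz (r z w : K) : K := r^2-6*z^2*r-2*(z+w)*fB r z w-2*(z+2*w)*fB r z w-2*(z+2*w)*(z+w)*fBz r z w
def fGzz (r z w : K) : K := -6*z*r^2+12*z^5-4*fB r z w*fBz r z w-2*(z+2*w)*fBz r z w^2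
  -2*(z+2*w)*fB r z w*(-6*z+2*w)

lemma pderiv_num (i : Fin 4) (n : ℕ) [n.AtLeastTwo] :
    pderiv i (no_index (OfNat.ofNat n) : MvPolynomial (Fin 4) K) = 0 :=
  Derivation.map_natCast (pderiv i) n

variable [CharP K 5]

lemma d0 (v : Fin 4 → K) : eval v (pderiv 0 (S5 K)) =
    ((v 0 + 2 * v 1)^6 + (v 0 - 2 * v 1) * fGr (v 0^2+v 1^2) (v 2) (v 3))
      + ((v 0 - 2 * v 1)^6 + (v 0 + 2 * v 1) * fGr (v 0^2+v 1^2) (v 2) (v 3)) := by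
  simp [S5, Psept, Usept, pderiv_X, Derivation.leibniz, Derivation.leibniz_pow, pderiv_num]
  simp only [fGr, fB, fGz, fBz, fC, fGrr, fGrz, fGzz]
  generalize v 0 = x
  generalize v 1 = y
  generalize v 2 = z
  generalize v 3 = w
  grind

lemma d1 (v : Fin 4 → K) : eval v (pderiv 1 (S5 K)) =
    2 * ((v 0 + 2 * v 1)^6 + (v 0 - 2 * v 1) * fGr (v 0^2+v 1^2) (v 2) (v 3))
      - 2 * ((v 0 - 2 * v 1)^6 + (v 0 + 2 * v 1) * fGr (v 0^2+v 1^2) (v 2) (v 3)) := by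
  simp [S5, Psept, Usept, pderiv_X, Derivation.leibniz, Derivation.leibniz_pow, pderiv_num]
  simp only [fGr, fB, fGz, fBz, fC, fGrr, fGrz, fGzz]
  generalize v 0 = x
  generalize v 1 = y
  generalize v 2 = z
  generalize v 3 = w
  grind

lemma d2 (v : Fin 4 → K) : eval v (pderiv 2 (S5 K)) =
    fGz (v 0^2+v 1^2) (v 2) (v 3) := by
  simp [S5, Psept, Usept, pderiv_X, Derivation.leibniz, Derivation.leibniz_pow, pderiv_num]
  simp only [fGr, fB, fGz, fBz, fC, fGrr, fGrz, fGzz]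
  generalize v 0 = x
  generalize v 1 = y
  generalize v 2 = z
  generalize v 3 = w
  grind

lemma d3 (v : Fin 4 → K) : eval v (pderiv 3 (S5 K)) =
    -2 * fB (v 0^2+v 1^2) (v 2) (v 3) * fC (v 0^2+v 1^2) (v 2) (v 3) := by
  simp [S5, Psept, Usept, pderiv_X, Derivation.leibniz, Derivation.leibniz_pow, pderiv_num]
  simp only [fGr, fB, fGz, fBz, fC, fGrr, fGrz, fGzz]
  generalize v 0 = x
  generalize v 1 = y
  generalize v 2 = z
  generalize v 3 = w
  grind

lemma d00 (v : Fin 4 → K) : eval v (pderiv 0 (pderiv 0 (S5 K))) =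
    ((v 0 + 2 * v 1)^5 + (v 0 - 2 * v 1)^2 * fGrr (v 0^2+v 1^2) (v 2) (v 3)) + 2 * (fGr (v 0^2+v 1^2) (v 2) (v 3) + (v 0^2+v 1^2) * fGrr (v 0^2+v 1^2) (v 2) (v 3))
      + ((v 0 - 2 * v 1)^5 + (v 0 + 2 * v 1)^2 * fGrr (v 0^2+v 1^2) (v 2) (v 3)) := by
  simp [S5, Psept, Usept, pderiv_X, Derivation.leibniz, Derivation.leibniz_pow, pderiv_num]
  simp only [fGr, fB, fGz, fBz, fC, fGrr, fGrz, fGzz]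
  generalize v 0 = x
  generalize v 1 = y
  generalize v 2 = z
  generalize v 3 = w
  grind

lemma d01 (v : Fin 4 → K) : eval v (pderiv 0 (pderiv 1 (S5 K))) =
    2 * ((v 0 + 2 * v 1)^5 + (v 0 - 2 * v 1)^2 * fGrr (v 0^2+v 1^2) (v 2) (v 3))
      - 2 * ((v 0 - 2 * v 1)^5 + (v 0 + 2 * v 1)^2 * fGrr (v 0^2+v 1^2) (v 2) (v 3)) := by
  simp [S5, Psept, Usept, pderiv_X, Derivation.leibniz, Derivation.leibniz_pow, pderiv_num]
  simp only [fGr, fB, fGz, fBz, fC, fGrr, fGrz, fGzz]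
  generalize v 0 = x
  generalize v 1 = y
  generalize v 2 = z
  generalize v 3 = w
  grind

lemma d02 (v : Fin 4 → K) : eval v (pderiv 0 (pderiv 2 (S5 K))) =
    2 * v 0 * fGrz (v 0^2+v 1^2) (v 2) (v 3) := by
  simp [S5, Psept, Usept, pderiv_X, Derivation.leibniz, Derivation.leibniz_pow, pderiv_num]
  simp only [fGr, fB, fGz, fBz, fC, fGrr, fGrz, fGzz]
  generalize v 0 = x
  generalize v 1 = y
  generalize v 2 = z
  generalize v 3 = w
  grind

lemma d10 (v : Fin 4 → K) : eval v (pderiv 1 (pderiv 0 (S5 K))) =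
    2 * ((v 0 + 2 * v 1)^5 + (v 0 - 2 * v 1)^2 * fGrr (v 0^2+v 1^2) (v 2) (v 3))
      - 2 * ((v 0 - 2 * v 1)^5 + (v 0 + 2 * v 1)^2 * fGrr (v 0^2+v 1^2) (v 2) (v 3)) := by
  simp [S5, Psept, Usept, pderiv_X, Derivation.leibniz, Derivation.leibniz_pow, pderiv_num]
  simp only [fGr, fB, fGz, fBz, fC, fGrr, fGrz, fGzz]
  generalize v 0 = x
  generalize v 1 = y
  generalize v 2 = z
  generalize v 3 = w
  grind

lemma d11 (v : Fin 4 → K) : eval v (pderiv 1 (pderiv 1 (S5 K))) =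
    4 * ((v 0 + 2 * v 1)^5 + (v 0 - 2 * v 1)^2 * fGrr (v 0^2+v 1^2) (v 2) (v 3)) - 8 * (fGr (v 0^2+v 1^2) (v 2) (v 3) + (v 0^2+v 1^2) * fGrr (v 0^2+v 1^2) (v 2) (v 3))
      + 4 * ((v 0 - 2 * v 1)^5 + (v 0 + 2 * v 1)^2 * fGrr (v 0^2+v 1^2) (v 2) (v 3)) := by
  simp [S5, Psept, Usept, pderiv_X, Derivation.leibniz, Derivation.leibniz_pow, pderiv_num]
  simp only [fGr, fB, fGz, fBz, fC, fGrr, fGrz, fGzz]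
  generalize v 0 = x
  generalize v 1 = y
  generalize v 2 = z
  generalize v 3 = w
  grind

lemma d12 (v : Fin 4 → K) : eval v (pderiv 1 (pderiv 2 (S5 K))) =
    2 * v 1 * fGrz (v 0^2+v 1^2) (v 2) (v 3) := by
  simp [S5, Psept, Usept, pderiv_X, Derivation.leibniz, Derivation.leibniz_pow, pderiv_num]
  simp only [fGr, fB, fGz, fBz, fC, fGrr, fGrz, fGzz]
  generalize v 0 = x
  generalize v 1 = y
  generalize v 2 = z
  generalize v 3 = w
  grind

lemma d20 (v : Fin 4 → K) : eval v (pderiv 2 (pderiv 0 (S5 K))) =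
    2 * v 0 * fGrz (v 0^2+v 1^2) (v 2) (v 3) := by
  simp [S5, Psept, Usept, pderiv_X, Derivation.leibniz, Derivation.leibniz_pow, pderiv_num]
  simp only [fGr, fB, fGz, fBz, fC, fGrr, fGrz, fGzz]
  generalize v 0 = x
  generalize v 1 = y
  generalize v 2 = z
  generalize v 3 = w
  grind

lemma d21 (v : Fin 4 → K) : eval v (pderiv 2 (pderiv 1 (S5 K))) =
    2 * v 1 * fGrz (v 0^2+v 1^2) (v 2) (v 3) := by
  simp [S5, Psept, Usept, pderiv_X, Derivation.leibniz, Derivation.leibniz_pow, pderiv_num]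
  simp only [fGr, fB, fGz, fBz, fC, fGrr, fGrz, fGzz]
  generalize v 0 = x
  generalize v 1 = y
  generalize v 2 = z
  generalize v 3 = w
  grind

lemma d22 (v : Fin 4 → K) : eval v (pderiv 2 (pderiv 2 (S5 K))) =
    fGzz (v 0^2+v 1^2) (v 2) (v 3) := by
  simp [S5, Psept, Usept, pderiv_X, Derivation.leibniz, Derivation.leibniz_pow, pderiv_num]
  simp only [fGr, fB, fGz, fBz, fC, fGrr, fGrz, fGzz]
  generalize v 0 = x
  generalize v 1 = y
  generalize v 2 = z
  generalize v 3 = w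
  grind


lemma c2 : (2:K) ≠ 0 := by
  intro h
  have : (5:K) = 0 := by exact_mod_cast CharP.cast_eq_zero K 5
  grind

lemma fifth_inj {a b : K} (h : a^5 = b^5) : a = b := by
  have h1 : (a - b)^5 = 0 := by
    have : (a - b)^5 = a^5 - b^5 := by grind
    rw [this, h, sub_self]
  exact sub_eq_zero.mp (pow_eq_zero_iff (by norm_num) |>.mp h1)

lemma sing_iff (v : Fin 4 → K) : VanishingJacobianAt (S5 K) v ↔
    ((v 0 + 2 * v 1)^6 + (v 0 - 2 * v 1) * fGr (v 0^2+v 1^2) (v 2) (v 3) = 0 ∧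
     (v 0 - 2 * v 1)^6 + (v 0 + 2 * v 1) * fGr (v 0^2+v 1^2) (v 2) (v 3) = 0 ∧
     fGz (v 0^2+v 1^2) (v 2) (v 3) = 0 ∧
     fB (v 0^2+v 1^2) (v 2) (v 3) * fC (v 0^2+v 1^2) (v 2) (v 3) = 0) := by
  unfold VanishingJacobianAt
  rw [Fin.forall_fin_succ, Fin.forall_fin_succ, Fin.forall_fin_succ, Fin.forall_fin_succ]
  have e1 : (Fin.succ 0 : Fin 4) = 1 := rfl
  have e2 : (Fin.succ (Fin.succ 0) : Fin 4) = 2 := rfl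
  have e3 : (Fin.succ (Fin.succ (Fin.succ 0)) : Fin 4) = 3 := rfl
  rw [e1, e2, e3, d0, d1, d2, d3]
  generalize (v 0 + 2 * v 1)^6 + (v 0 - 2 * v 1) * fGr (v 0^2+v 1^2) (v 2) (v 3) = p
  generalize (v 0 - 2 * v 1)^6 + (v 0 + 2 * v 1) * fGr (v 0^2+v 1^2) (v 2) (v 3) = q
  generalize fGz (v 0^2+v 1^2) (v 2) (v 3) = s
  generalize fB (v 0^2+v 1^2) (v 2) (v 3) = b
  generalize fC (v 0^2+v 1^2) (v 2) (v 3) = c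
  constructor
  · rintro ⟨h0, h1, h2, h3, -⟩
    refine ⟨?_, ?_, h2, ?_⟩ <;> grind
  · rintro ⟨h0, h1, h2, h3⟩
    refine ⟨?_, ?_, h2, ?_, fun i => i.elim0⟩ <;> grind

/-- Singular points off the axis, in the mirror plane and the chart `w = 1`. -/
def PA (x z : K) : Prop :=
  x ≠ 0 ∧ x^5 = - fGr (x^2) z 1 ∧ fGz (x^2) z 1 = 0 ∧ fB (x^2) z 1 * fC (x^2) z 1 = 0

lemma caseB {x z : K} (hx : x ≠ 0) (h1 : x^5 = - fGr (x^2) z 1) (h2 : fGz (x^2) z 1 = 0)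
    (hB : fB (x^2) z 1 = 0) :
    z ≠ 0 ∧ ((x/z)^3+4*(x/z)^2+(x/z)+2=0 ∧
      ((x/z)^2-1)*z^3+(1+(x/z)^2)*z^2+3*z-1=0) := by
  simp only [fGr, fGz, hB] at h1 h2
  have hz : z ≠ 0 := by
    rintro rfl
    apply hx
    have : x^6 = 0 := by grind
    exact pow_eq_zero_iff (by norm_num) |>.mp this
  refine ⟨hz, ?_⟩
  obtain ⟨t, rfl⟩ : ∃ t, x = t * z := ⟨x / z, by field_simp⟩
  rw [mul_div_cancel_right₀ _ hz]
  have h3 : t^5 + t^4 - 2*t^2+2 = 0 := by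
    have : z^5 * (t^5 + t^4 - 2*t^2+2) = 0 := by linear_combination h1
    exact (mul_eq_zero.mp this).resolve_left (pow_ne_zero _ hz)
  have h4 : 2*t^6-3*t^4+2 = 0 := by
    have : z^6 * (2*t^6-3*t^4+2) = 0 := by linear_combination h2
    exact (mul_eq_zero.mp this).resolve_left (pow_ne_zero _ hz)
  clear h1 h2
  simp only [fB] at hB
  constructor
  · clear hB hz
    grind
  · linear_combination hB

lemma caseC {x z : K} (hx : x ≠ 0) (h1 : x^5 = - fGr (x^2) z 1) (h2 : fGz (x^2) z 1 = 0)
    (hC : fC (x^2) z 1 = 0) :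
    (x = 2 ∧ z = 0) ∨ (x = 1 ∧ z = 2) ∨ (z^3+4*z^2+4*z+2=0 ∧ x = 1+z+z^2) := by
  have hD : 2*z+3 ≠ 0 := by
    intro h
    simp only [fC] at hC
    have h1 : z = 1 := by grind
    subst h1
    have h2 := @c2 K _ _
    grind
  have hr : x^2 ≠ 0 := pow_ne_zero _ hx
  have h3 : z*(z+1)^2*(z+3)*(z^3+4*z^2+4*z+2) = 0 := by
    clear h1 hx hr hD
    simp only [fC, fGz, fB, fBz] at hC h2
    generalize x^2 = r at *
    grind
  rcases mul_eq_zero.mp h3 with h3 | h3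
  · rcases mul_eq_zero.mp h3 with h3 | h3
    · rcases mul_eq_zero.mp h3 with h3 | h3
      · left
        refine ⟨fifth_inj ?_, h3⟩
        subst h3
        simp only [fC, fGr, fB] at hC h1
        grind
      · exfalso
        have : z = -1 := by
          have := pow_eq_zero_iff (by norm_num) |>.mp h3
          grind
        subst this
        apply hr
        simp only [fC] at hC
        grind
    · right; left
      have : z = 2 := by grind
      refine ⟨fifth_inj ?_, this⟩
      subst this
      simp only [fC, fGr, fB] at hC h1
      have : x^2 = 1 := by grind
      grind
  · right; right
    refine ⟨h3, fifth_inj ?_⟩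
    have : x^2 = 3*z+2*z^2 := by
      apply mul_left_cancel₀ hD
      simp only [fC] at hC
      grind
    rw [h1, this]
    simp only [fGr, fB]
    grind

lemma PA_iff (x z : K) : PA x z ↔
    (z ≠ 0 ∧ ((x/z)^3+4*(x/z)^2+(x/z)+2=0 ∧
      ((x/z)^2-1)*z^3+(1+(x/z)^2)*z^2+3*z-1=0)) ∨
    (x = 2 ∧ z = 0) ∨ (x = 1 ∧ z = 2) ∨ (z^3+4*z^2+4*z+2=0 ∧ x = 1+z+z^2) := by
  have h22 := @c2 K _ _
  constructor
  · rintro ⟨hx, h1, h2, h3⟩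
    rcases mul_eq_zero.mp h3 with h | h
    · exact Or.inl (caseB hx h1 h2 h)
    · exact Or.inr (caseC hx h1 h2 h)
  · rintro (⟨hz, h1, h2⟩ | ⟨rfl, rfl⟩ | ⟨rfl, rfl⟩ | ⟨h1, rfl⟩)
    · obtain ⟨t, rfl⟩ : ∃ t, x = t * z := ⟨x / z, by field_simp⟩
      rw [mul_div_cancel_right₀ _ hz] at h1 h2
      have hB : fB ((t*z)^2) z 1 = 0 := by
        simp only [fB]; linear_combination h2
      have ht : t ≠ 0 := by
        rintro rfl
        grind
      refine ⟨mul_ne_zero ht hz, ?_, ?_, by rw [hB, zero_mul]⟩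
      · simp only [fGr, hB]
        clear h2 hB
        have h3 : t^5 + t^4 - 2*t^2+2 = 0 := by grind
        linear_combination z^5 * h3
      · simp only [fGz, hB]
        clear h2 hB
        have h3 : 2*t^6-3*t^4+2 = 0 := by grind
        linear_combination z^6 * h3
    · refine ⟨h22, ?_, ?_, ?_⟩ <;> simp only [fGr, fGz, fB, fBz, fC] <;> grind
    · refine ⟨one_ne_zero, ?_, ?_, ?_⟩ <;> simp only [fGr, fGz, fB, fBz, fC] <;> grind
    · refine ⟨?_, ?_, ?_, ?_⟩
      · intro h
        grind
      · simp only [fGr, fB]; grind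
      · simp only [fGz, fB, fBz]; grind
      · have : fC ((1+z+z^2)^2) z 1 = 0 := by
          simp only [fC]; grind
        rw [this, mul_zero]

lemma nondeg {x z : K} (h : PA x z) :
    fGrr (x^2) z 1 * fGzz (x^2) z 1 - fGrz (x^2) z 1 ^ 2 ≠ 0 := by
  have h22 := @c2 K _ _
  rcases (PA_iff x z).mp h with (⟨hz, h1, h2⟩ | ⟨rfl, rfl⟩ | ⟨rfl, rfl⟩ | ⟨h1, rfl⟩)
  · obtain ⟨t, rfl⟩ : ∃ t, x = t * z := ⟨x / z, by field_simp⟩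
    rw [mul_div_cancel_right₀ _ hz] at h1 h2
    have hB : fB ((t*z)^2) z 1 = 0 := by
      simp only [fB]; linear_combination h2
    intro h3
    simp only [fGrr, fGrz, fGzz, fBz, hB] at h3
    clear hB h hz
    grind
  · intro h3
    simp only [fGrr, fGrz, fGzz, fBz, fB] at h3
    grind
  · intro h3
    simp only [fGrr, fGrz, fGzz, fBz, fB] at h3
    grind
  · intro h3
    simp only [fGrr, fGrz, fGzz, fBz, fB] at h3
    clear h
    grind


lemma rank3 (M : Matrix (Fin 4) (Fin 4) K) (v : Fin 4 → K) (hv : v ≠ 0)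
    (hM : Matrix.vecMul v M = 0) (f : Fin 3 → Fin 4) (hd : (M.submatrix f f).det ≠ 0) :
    M.rank = 3 := by
  apply le_antisymm
  · have h4 : M.rank ≤ 4 := by simpa using M.rank_le_card_width
    by_contra hlt
    have h : M.rank = 4 := by omega
    have hdet : M.det = 0 := Matrix.exists_vecMul_eq_zero_iff.mp ⟨v, hv, hM⟩
    obtain ⟨w, hw, hMw⟩ := Matrix.exists_mulVec_eq_zero_iff.mpr hdet
    have hn := M.mulVecLin.finrank_range_add_finrank_ker
    rw [Module.finrank_fin_fun] at hn
    have hk : 0 < Module.finrank K (LinearMap.ker M.mulVecLin) := by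
      apply Module.finrank_pos_iff_exists_ne_zero.mpr
      exact ⟨⟨w, by simpa using hMw⟩, fun h => hw (congrArg Subtype.val h)⟩
    have : M.rank = Module.finrank K (LinearMap.range M.mulVecLin) := rfl
    omega
  · have h := Matrix.rank_submatrix_le M f f
    have h2 : (M.submatrix f f).rank = 3 := by
      have : IsUnit (M.submatrix f f) := by
        rw [Matrix.isUnit_iff_isUnit_det]
        exact isUnit_iff_ne_zero.mpr hd
      simpa using Matrix.rank_of_isUnit _ this
    omega

lemma euler (v : Fin 4 → K) (j : Fin 4) :
    v 0 * eval v (pderiv 0 (pderiv j (S5 K))) + v 1 * eval v (pderiv 1 (pderiv j (S5 K)))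
     + v 2 * eval v (pderiv 2 (pderiv j (S5 K))) + v 3 * eval v (pderiv 3 (pderiv j (S5 K)))
     = 6 * eval v (pderiv j (S5 K)) := by
  fin_cases j <;>
  · simp [S5, Psept, Usept, pderiv_X, Derivation.leibniz, Derivation.leibniz_pow, pderiv_num]
    ring

lemma euler_vec (v : Fin 4 → K) (h : VanishingJacobianAt (S5 K) v) :
    Matrix.vecMul v (hessianAt (S5 K) v) = 0 := by
  funext j
  have := euler v j
  rw [h j, mul_zero] at this
  simpa [Matrix.vecMul, dotProduct, Fin.sum_univ_four, hessianAt] using this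

lemma minor_formula (ξ η G g h k : K) (h0 : ξ^6 + η * G = 0) (h1 : η^6 + ξ * G = 0)
    (hr : ξ * η ≠ 0) :
    (!![(ξ^5 + η^2*g) + 2*(G + ξ*η*g) + (η^5+ξ^2*g), 2*(ξ^5 + η^2*g) - 2*(η^5+ξ^2*g),
          2*(3*(ξ+η))*h;
        2*(ξ^5 + η^2*g) - 2*(η^5+ξ^2*g), 4*(ξ^5 + η^2*g) - 8*(G + ξ*η*g) + 4*(η^5+ξ^2*g),
          2*(η-ξ)*h;
        2*(3*(ξ+η))*h, 2*(η-ξ)*h, k]).det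
      = (ξ*η) * G * (g * k - h^2) := by
  have h3 : (ξ*η)^5 = G^2 := by
    apply mul_left_cancel₀ hr
    have a1 : ξ^6 = - η*G := by linear_combination h0
    have a2 : η^6 = - ξ*G := by linear_combination h1
    have : ξ*η*(ξ*η)^5 = ξ^6*η^6 := by ring
    rw [this, a1, a2]; ring
  have h4 : ξ^7 = -(ξ*η)*G := by linear_combination ξ*h0
  have h5 : η^7 = -(ξ*η)*G := by linear_combination η*h1
  rw [Matrix.det_fin_three]
  simp
  have e : ((ξ^5 + η^2*g) + 2*(G + ξ*η*g) + (η^5+ξ^2*g)) * (4*(ξ^5 + η^2*g) - 8*(G + ξ*η*g) + 4*(η^5+ξ^2*g)) - (2*(ξ^5 + η^2*g) - 2*(η^5+ξ^2*g))^2 = (ξ*η)*G*g := by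
    have : ((ξ^5 + η^2*g) + 2*(G + ξ*η*g) + (η^5+ξ^2*g)) * (4*(ξ^5 + η^2*g) - 8*(G + ξ*η*g) + 4*(η^5+ξ^2*g)) - (2*(ξ^5 + η^2*g) - 2*(η^5+ξ^2*g))^2 = (ξ*η)^5 + g*(ξ^7+η^7) - G^2 - 2*(ξ*η)*g*G := by grind
    rw [this, h3, h4, h5]
    grind
  have e2 : (3*(ξ+η))^2 * (4*(ξ^5 + η^2*g) - 8*(G + ξ*η*g) + 4*(η^5+ξ^2*g)) - 2*(3*(ξ+η))*(η-ξ)*(2*(ξ^5 + η^2*g) - 2*(η^5+ξ^2*g)) + (η-ξ)^2*((ξ^5 + η^2*g) + 2*(G + ξ*η*g) + (η^5+ξ^2*g)) = -1*((ξ*η)*G) := by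
    have : (3*(ξ+η))^2 * (4*(ξ^5 + η^2*g) - 8*(G + ξ*η*g) + 4*(η^5+ξ^2*g)) - 2*(3*(ξ+η))*(η-ξ)*(2*(ξ^5 + η^2*g) - 2*(η^5+ξ^2*g)) + (η-ξ)^2*((ξ^5 + η^2*g) + 2*(G + ξ*η*g) + (η^5+ξ^2*g)) = -1*(ξ^7 + η^7 - 2*(ξ*η)*G)  := by grind
    rw [this, h4, h5]
    grind
  generalize ξ^5 + η^2*g = A at *
  generalize η^5 + ξ^2*g = B at *
  generalize G + ξ*η*g = C at *
  have h55 : (5:K) = 0 := by exact_mod_cast CharP.cast_eq_zero K 5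
  linear_combination k * e - 4*h^2*e2 + h^2*(ξ*η*G)*h55

/-- The rotated point. -/
def pt (ω x z : K) : Fin 4 → K := ![3*(ω*x+ω^6*x), ω^6*x-ω*x, z, 1]

lemma pt_rel (ω x z : K) (hω : ω^7 = 1) :
    pt ω x z 0 + 2 * pt ω x z 1 = ω*x ∧ pt ω x z 0 - 2 * pt ω x z 1 = ω^6*x ∧
    pt ω x z 0^2 + pt ω x z 1^2 = x^2 ∧ pt ω x z 2 = z ∧ pt ω x z 3 = 1 := by
  refine ⟨?_, ?_, ?_, rfl, rfl⟩
  · show 3*(ω*x+ω^6*x) + 2*(ω^6*x-ω*x) = ω*x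
    grind
  · show 3*(ω*x+ω^6*x) - 2*(ω^6*x-ω*x) = ω^6*x
    grind
  · show (3*(ω*x+ω^6*x))^2 + (ω^6*x-ω*x)^2 = x^2
    have : (3*(ω*x+ω^6*x))^2 + (ω^6*x-ω*x)^2 = ω^7*x^2 := by grind
    rw [this, hω, one_mul]

lemma pt_eqs {ω x z : K} (hω : ω^7 = 1) (h : PA x z) :
    (ω*x)^6 + ω^6*x * fGr (x^2) z 1 = 0 ∧ (ω^6*x)^6 + ω*x * fGr (x^2) z 1 = 0 := by
  obtain ⟨hx, h1, h2, h3⟩ := h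
  constructor
  · linear_combination ω^6*x*h1
  · have : (ω^6)^6 = ω := by
      have : (ω^6)^6 = (ω^7)^5*ω := by ring
      rw [this, hω]; ring
    have : (ω^6*x)^6 = ω * x^6 := by rw [mul_pow, this]
    rw [this]
    linear_combination ω*x*h1

lemma sing_pt {ω x z : K} (hω : ω^7 = 1) (h : PA x z) :
    VanishingJacobianAt (S5 K) (pt ω x z) := by
  rw [sing_iff]
  obtain ⟨e1, e2, e3, e4, e5⟩ := pt_rel ω x z hω
  rw [e1, e2, e3, e4, e5]
  obtain ⟨f1, f2⟩ := pt_eqs hω h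
  exact ⟨f1, f2, h.2.2.1, h.2.2.2⟩

lemma pt_ne (ω x z : K) : pt ω x z ≠ 0 := by
  intro h
  have := congrFun h 3
  simp [pt] at this

/-- The `3 × 3` minor of the Hessian. -/
def minorM (ξ η G g h k : K) : Matrix (Fin 3) (Fin 3) K :=
  !![(ξ^5 + η^2*g) + 2*(G + ξ*η*g) + (η^5+ξ^2*g), 2*(ξ^5 + η^2*g) - 2*(η^5+ξ^2*g),
        2*(3*(ξ+η))*h;
      2*(ξ^5 + η^2*g) - 2*(η^5+ξ^2*g), 4*(ξ^5 + η^2*g) - 8*(G + ξ*η*g) + 4*(η^5+ξ^2*g),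
        2*(η-ξ)*h;
      2*(3*(ξ+η))*h, 2*(η-ξ)*h, k]

lemma hess_pt {ω x z : K} (hω : ω^7 = 1) (h : PA x z) :
    (hessianAt (S5 K) (pt ω x z)).rank = 3 := by
  apply rank3 _ _ (pt_ne ω x z) (euler_vec _ (sing_pt hω h)) ![0, 1, 2]
  obtain ⟨e1, e2, e3, e4, e5⟩ := pt_rel ω x z hω
  obtain ⟨f1, f2⟩ := pt_eqs hω h
  have hw0 : ω ≠ 0 := by
    rintro rfl
    simp at hω
  have hr : ω*x*(ω^6*x) = x^2 := by
    have : ω*x*(ω^6*x) = ω^7*x^2 := by ring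
    rw [this, hω, one_mul]
  have hM : (hessianAt (S5 K) (pt ω x z)).submatrix ![0, 1, 2] ![0, 1, 2] =
    minorM (ω*x) (ω^6*x) (fGr (x^2) z 1) (fGrr (x^2) z 1) (fGrz (x^2) z 1) (fGzz (x^2) z 1) := by
    have p0 : pt ω x z 0 = 3*(ω*x+ω^6*x) := rfl
    have p1 : pt ω x z 1 = ω^6*x-ω*x := rfl
    unfold minorM
    rw [hr]
    ext i j
    fin_cases i <;> fin_cases j
    · refine (d00 _).trans ?_
      rw [e1, e2, e3, e4, e5]; rfl
    · refine (d01 _).trans ?_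
      rw [e1, e2, e3, e4, e5]; rfl
    · refine (d02 _).trans ?_
      rw [e3, e4, e5, p0]; rfl
    · refine (d10 _).trans ?_
      rw [e1, e2, e3, e4, e5]; rfl
    · refine (d11 _).trans ?_
      rw [e1, e2, e3, e4, e5]; rfl
    · refine (d12 _).trans ?_
      rw [e3, e4, e5, p1]; rfl
    · refine (d20 _).trans ?_
      rw [e3, e4, e5, p0]; rfl
    · refine (d21 _).trans ?_
      rw [e3, e4, e5, p1]; rfl
    · refine (d22 _).trans ?_
      rw [e3, e4, e5]; rfl
  rw [hM]
  have hx := h.1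
  have hxx : ω*x*(ω^6*x) ≠ 0 := by
    rw [hr]; exact pow_ne_zero _ hx
  have : (minorM _ _ _ _ _ _).det = _ := minor_formula (ω*x) (ω^6*x) (fGr (x^2) z 1) (fGrr (x^2) z 1) (fGrz (x^2) z 1)
    (fGzz (x^2) z 1) f1 f2 hxx
  rw [this]
  refine mul_ne_zero (mul_ne_zero hxx ?_) (nondeg h)
  intro h0
  have := h.2.1
  rw [h0, neg_zero] at this
  exact hx (pow_eq_zero_iff (by norm_num) |>.mp this)

/-- The two singular points on the axis. -/
def ax1 (K : Type*) [Field K] : Fin 4 → K := ![0, 0, 1, 0]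
def ax2 (K : Type*) [Field K] : Fin 4 → K := ![0, 0, -1, 1]

lemma sing_ax1 : VanishingJacobianAt (S5 K) (ax1 K) := by
  rw [sing_iff]
  simp [ax1, fGr, fGz, fB, fBz, fC]
  grind

lemma sing_ax2 : VanishingJacobianAt (S5 K) (ax2 K) := by
  rw [sing_iff]
  simp [ax2, fGr, fGz, fB, fBz, fC]
  grind

lemma ax1_ne : ax1 K ≠ 0 := fun h => by simpa [ax1] using congrFun h 2
lemma ax2_ne : ax2 K ≠ 0 := fun h => by simpa [ax2] using congrFun h 3

lemma hess_ax2 : (hessianAt (S5 K) (ax2 K)).rank = 3 := by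
  apply rank3 _ _ ax2_ne (euler_vec _ sing_ax2) ![0, 1, 2]
  rw [Matrix.det_fin_three]
  simp [hessianAt, d00, d01, d02, d10, d11, d12, d20, d21, d22]
  simp [ax2, fGr, fGrr, fGz, fB, fBz, fGzz]
  have := @c2 K _ _
  constructor <;> grind

lemma hess_ax1 : (hessianAt (S5 K) (ax1 K)).rank = 3 := by
  apply rank3 _ _ ax1_ne (euler_vec _ sing_ax1) ![0, 1, 3]
  have h03 : eval (ax1 K) (pderiv 0 (pderiv 3 (S5 K))) = 0 := by
    simp [S5, Psept, Usept, pderiv_X, Derivation.leibniz, Derivation.leibniz_pow, pderiv_num, ax1]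
  have h13 : eval (ax1 K) (pderiv 1 (pderiv 3 (S5 K))) = 0 := by
    simp [S5, Psept, Usept, pderiv_X, Derivation.leibniz, Derivation.leibniz_pow, pderiv_num, ax1]
  have h33 : eval (ax1 K) (pderiv 3 (pderiv 3 (S5 K))) = 3 := by
    simp [S5, Psept, Usept, pderiv_X, Derivation.leibniz, Derivation.leibniz_pow, pderiv_num, ax1]
    grind
  rw [Matrix.det_fin_three]
  simp [hessianAt, d00, d01, d10, d11, h03, h13, h33]
  simp [ax1, fGr, fGrr, fB]
  have := @c2 K _ _
  grind

lemma sing_smul {v : Fin 4 → K} (c : K) (h : VanishingJacobianAt (S5 K) v) :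
    VanishingJacobianAt (S5 K) (c • v) := by
  rw [sing_iff] at h ⊢
  obtain ⟨h0, h1, h2, h3⟩ := h
  simp only [Pi.smul_apply, smul_eq_mul]
  have e1 : ∀ r z w : K, fGr (c^2*r) (c*z) (c*w) = c^5 * fGr r z w := by
    intro r z w; simp only [fGr, fB]; ring
  have e2 : ∀ r z w : K, fGz (c^2*r) (c*z) (c*w) = c^6 * fGz r z w := by
    intro r z w; simp only [fGz, fB, fBz]; ring
  have e3 : ∀ r z w : K, fB (c^2*r) (c*z) (c*w) = c^3 * fB r z w := by
    intro r z w; simp only [fB]; ring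
  have e4 : ∀ r z w : K, fC (c^2*r) (c*z) (c*w) = c^3 * fC r z w := by
    intro r z w; simp only [fC]; ring
  have e5 : (c * v 0)^2 + (c * v 1)^2 = c^2 * (v 0^2 + v 1^2) := by ring
  rw [e5, e1, e2, e3, e4]
  refine ⟨?_, ?_, ?_, ?_⟩
  · linear_combination c^6*h0
  · linear_combination c^6*h1
  · linear_combination c^6*h2
  · linear_combination c^6*h3

lemma classify_affine {v : Fin 4 → K} (h : VanishingJacobianAt (S5 K) v) (hw : v 3 = 1)
    (hr : v 0^2 + v 1^2 ≠ 0) : ∃ ω x z : K, ω^7 = 1 ∧ PA x z ∧ v = pt ω x z := by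
  rw [sing_iff, hw] at h
  obtain ⟨h0, h1, h2, h3⟩ := h
  obtain ⟨ξ, hξ⟩ : ∃ ξ, ξ = v 0 + 2 * v 1 := ⟨_, rfl⟩
  obtain ⟨η, hη⟩ : ∃ η, η = v 0 - 2 * v 1 := ⟨_, rfl⟩
  have hv0 : v 0 = 3*(ξ+η) := by grind
  have hv1 : v 1 = η - ξ := by grind
  have hrr : v 0^2 + v 1^2 = ξ*η := by grind
  rw [← hξ, ← hη, hrr] at h0 h1
  rw [hrr] at h2 h3 hr
  have hξ0 : ξ ≠ 0 := left_ne_zero_of_mul hr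
  obtain ⟨ζ, rfl⟩ : ∃ ζ, η = ζ * ξ := ⟨η / ξ, by field_simp⟩
  have hζ : ζ^7 = 1 := by
    have : ξ^7 * (ζ^7 - 1) = 0 := by linear_combination (ζ*ξ) * h1 - ξ * h0
    have := (mul_eq_zero.mp this).resolve_left (pow_ne_zero _ hξ0)
    linear_combination this
  have hx2 : (ζ^4*ξ)^2 = ξ*(ζ*ξ) := by linear_combination ζ*ξ^2*hζ
  have hζ0 : ζ ≠ 0 := by
    rintro rfl
    simp at hζ
  have hx0 : ζ^4*ξ ≠ 0 := mul_ne_zero (pow_ne_zero _ hζ0) hξ0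
  refine ⟨ζ^3, ζ^4*ξ, v 2, ?_, ⟨hx0, ?_, ?_, ?_⟩, ?_⟩
  · rw [← pow_mul, mul_comm, pow_mul, hζ, one_pow]
  · rw [hx2]
    apply mul_left_cancel₀ (pow_ne_zero 2 hx0)
    have h28 : ζ^28 = 1 := by
      have : ζ^28 = (ζ^7)^4 := by ring
      rw [this, hζ, one_pow]
    rw [hx2]
    have : (ζ^4*ξ)^5 * (ξ * (ζ*ξ)) = ζ^28 * ξ^7 := by
      rw [← hx2]; ring
    linear_combination this + ξ^7*h28 + ξ*h0
  · rw [hx2]; exact h2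
  · rw [hx2]; exact h3
  · funext i
    fin_cases i
    · show v 0 = 3*(ζ^3*(ζ^4*ξ) + (ζ^3)^6*(ζ^4*ξ))
      have h22 : ζ^22 = ζ := by
        have : ζ^22 = (ζ^7)^3*ζ := by ring
        rw [this, hζ, one_pow, one_mul]
      rw [hv0]
      linear_combination (-3*ξ)*hζ - 3*ξ*h22
    · show v 1 = (ζ^3)^6*(ζ^4*ξ) - ζ^3*(ζ^4*ξ)
      have h22 : ζ^22 = ζ := by
        have : ζ^22 = (ζ^7)^3*ζ := by ring
        rw [this, hζ, one_pow, one_mul]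
      rw [hv1]
      linear_combination ξ*hζ - ξ*h22
    · rfl
    · exact hw

lemma w_ne {r z w : K} (hr : r ≠ 0) (h2 : fGz r z w = 0) (h3 : fB r z w * fC r z w = 0) :
    w ≠ 0 := by
  rintro rfl
  have h22 := @c2 K _ _
  have hz : z ≠ 0 := by
    rintro rfl
    simp [fGz, fB] at h2
    grind
  simp only [fGz, fB, fC, fBz] at h2 h3
  have h4 : z^2 * r * (r - z^2) = 0 := by grind
  have h5 : r = z^2 := by
    have := (mul_eq_zero.mp h4).resolve_left (mul_ne_zero (pow_ne_zero _ hz) hr)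
    linear_combination this
  subst h5
  have : z^6 = 0 := by grind
  exact pow_ne_zero 6 hz this

lemma classify {v : Fin 4 → K} (hv : v ≠ 0) (h : VanishingJacobianAt (S5 K) v) :
    ∃ c : K, c ≠ 0 ∧ (c • v = ax1 K ∨ c • v = ax2 K ∨
      ∃ ω x z : K, ω^7 = 1 ∧ PA x z ∧ c • v = pt ω x z) := by
  have h22 := @c2 K _ _
  have hh := h
  rw [sing_iff] at hh
  obtain ⟨h0, h1, h2, h3⟩ := hh
  by_cases hr : v 0^2 + v 1^2 = 0
  · rw [hr] at h0 h1 h2 h3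
    have hr' : (v 0 + 2 * v 1) * (v 0 - 2 * v 1) = 0 := by grind
    obtain ⟨hξ, hη⟩ : v 0 + 2 * v 1 = 0 ∧ v 0 - 2 * v 1 = 0 := by
      rcases mul_eq_zero.mp hr' with h | h
      · rw [h] at h1
        refine ⟨h, ?_⟩
        have : (v 0 - 2 * v 1)^6 = 0 := by linear_combination h1
        exact pow_eq_zero_iff (by norm_num) |>.mp this
      · rw [h] at h0
        refine ⟨?_, h⟩
        have : (v 0 + 2 * v 1)^6 = 0 := by linear_combination h0
        exact pow_eq_zero_iff (by norm_num) |>.mp this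
    have hv0 : v 0 = 0 := by grind
    have hv1 : v 1 = 0 := by grind
    have hzw : ¬ (v 2 = 0 ∧ v 3 = 0) := by
      rintro ⟨a, b⟩
      apply hv
      funext i
      fin_cases i
      · exact hv0
      · exact hv1
      · exact a
      · exact b
    rcases mul_eq_zero.mp h3 with hB | hC
    · exfalso
      simp only [fGz, hB] at h2
      have hz : v 2 = 0 := by
        have : v 2 ^ 6 = 0 := by grind
        exact pow_eq_zero_iff (by norm_num) |>.mp this
      simp only [fB, hz] at hB
      have : v 3 ^ 3 = 0 := by linear_combination -hB
      exact hzw ⟨hz, pow_eq_zero_iff (by norm_num) |>.mp this⟩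
    · have hC' : v 3 * ((v 2 + v 3) * (v 2 - 3 * v 3)) = 0 := by
        simp only [fC] at hC
        grind
      rcases mul_eq_zero.mp hC' with hw | hC'
      · have hz : v 2 ≠ 0 := fun hz => hzw ⟨hz, hw⟩
        refine ⟨(v 2)⁻¹, inv_ne_zero hz, Or.inl ?_⟩
        funext i
        fin_cases i
        · simp [ax1, hv0]
        · simp [ax1, hv1]
        · simp [ax1, hz]
        · simp [ax1, hw]
      · rcases mul_eq_zero.mp hC' with hz | hz
        · have hz' : v 2 = - v 3 := by linear_combination hz
          have hw : v 3 ≠ 0 := fun hw => hzw ⟨by rw [hz', hw, neg_zero], hw⟩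
          refine ⟨(v 3)⁻¹, inv_ne_zero hw, Or.inr (Or.inl ?_)⟩
          funext i
          fin_cases i
          · simp [ax2, hv0]
          · simp [ax2, hv1]
          · simp [ax2, hz', hw]
          · simp [ax2, hw]
        · exfalso
          have hz' : v 2 = 3 * v 3 := by linear_combination hz
          rw [hz'] at h2
          simp only [fGz, fB, fBz] at h2
          have : v 3 ^ 6 = 0 := by grind
          have hw := pow_eq_zero_iff (by norm_num) |>.mp this
          exact hzw ⟨by rw [hz', hw, mul_zero], hw⟩
  · have hw := w_ne hr h2 h3
    refine ⟨(v 3)⁻¹, inv_ne_zero hw, Or.inr (Or.inr ?_)⟩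
    apply classify_affine (sing_smul _ h)
    · simp [hw]
    · have : ((v 3)⁻¹ • v) 0 ^ 2 + ((v 3)⁻¹ • v) 1 ^ 2 = (v 3)⁻¹^2 * (v 0^2 + v 1^2) := by
        simp only [Pi.smul_apply, smul_eq_mul]; ring
      rw [this]
      exact mul_ne_zero (pow_ne_zero _ (inv_ne_zero hw)) hr

lemma cubic_roots [IsAlgClosed K] (a b c d : K) (ha : a ≠ 0)
    (hd : b ^ 2 * c ^ 2 - 4 * a * c ^ 3 - 4 * b ^ 3 * d - 27 * a ^ 2 * d ^ 2
      + 18 * a * b * c * d ≠ 0) :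
    ∃ s : Finset K, s.card = 3 ∧ ∀ x, x ∈ s ↔ a*x^3+b*x^2+c*x+d = 0 := by
  classical
  let P : Cubic K := ⟨a, b, c, d⟩
  have h := Cubic.card_roots_of_discr_ne_zero (P := P) (φ := RingHom.id K) ha
    (IsAlgClosed.splits _) hd
  refine ⟨_, h, fun x => ?_⟩
  have hmap : Cubic.map (RingHom.id K) P = P := rfl
  rw [Multiset.mem_toFinset, hmap, Cubic.mem_roots_iff (Cubic.ne_zero_of_a_ne_zero ha)]

lemma card_PA [IsAlgClosed K] : ∃ A : Finset (K × K), A.card = 14 ∧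
    ∀ p : K × K, p ∈ A ↔ PA p.1 p.2 := by
  classical
  have h22 := @c2 K _ _
  obtain ⟨T, hT, hT'⟩ := cubic_roots (K := K) 1 4 1 2 one_ne_zero (by grind)
  obtain ⟨Θ, hΘ, hΘ'⟩ := cubic_roots (K := K) 1 4 4 2 one_ne_zero (by grind)
  have hZ : ∀ t : K, ∃ s : Finset K, t ∈ T →
      (s.card = 3 ∧ ∀ z, z ∈ s ↔ (t^2-1)*z^3+(1+t^2)*z^2+3*z+(-1) = 0) := by
    intro t
    by_cases ht : t ∈ T
    · have h1 := (hT' t).mp ht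
      obtain ⟨s, hs⟩ := cubic_roots (K := K) (t^2-1) (1+t^2) 3 (-1) (by grind) (by grind)
      exact ⟨s, fun _ => hs⟩
    · exact ⟨∅, fun h => absurd h ht⟩
  choose Z hZ using hZ
  let A1 : Finset (K × K) := (T.sigma Z).image (fun p => (p.1 * p.2, p.2))
  let A2 : Finset (K × K) := Θ.image (fun z => (1+z+z^2, z))
  have hz0 : ∀ t ∈ T, ∀ z ∈ Z t, z ≠ 0 := by
    rintro t ht z hz rfl
    have := ((hZ t ht).2 _).mp hz
    grind
  have m1 : ∀ p : K × K, p ∈ A1 ↔ (p.2 ≠ 0 ∧ ((p.1/p.2)^3+4*(p.1/p.2)^2+(p.1/p.2)+2=0 ∧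
      ((p.1/p.2)^2-1)*p.2^3+(1+(p.1/p.2)^2)*p.2^2+3*p.2-1=0)) := by
    rintro ⟨x, z⟩
    simp only [A1, Finset.mem_image, Finset.mem_sigma, Prod.mk.injEq]
    constructor
    · rintro ⟨⟨t, z'⟩, ⟨ht, hz⟩, rfl, rfl⟩
      have h0 := hz0 t ht _ hz
      simp only
      refine ⟨h0, ?_⟩
      rw [mul_div_cancel_right₀ _ h0]
      have a := (hT' t).mp ht
      have b := ((hZ t ht).2 _).mp hz
      exact ⟨by linear_combination a, by linear_combination b⟩
    · rintro ⟨h0, a, b⟩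
      have ht : x / z ∈ T := (hT' _).mpr (by linear_combination a)
      refine ⟨⟨x/z, z⟩, ⟨ht, ((hZ _ ht).2 _).mpr (by linear_combination b)⟩, ?_, rfl⟩
      field_simp
  have m2 : ∀ p : K × K, p ∈ A2 ↔ (p.2^3+4*p.2^2+4*p.2+2=0 ∧ p.1 = 1+p.2+p.2^2) := by
    rintro ⟨x, z⟩
    simp only [A2, Finset.mem_image, Prod.mk.injEq, hΘ']
    constructor
    · rintro ⟨z', a, rfl, rfl⟩
      exact ⟨by linear_combination a, rfl⟩
    · rintro ⟨a, b⟩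
      exact ⟨z, by linear_combination a, b.symm, rfl⟩
  have k1 : A1.card = 9 := by
    rw [Finset.card_image_of_injOn, Finset.card_sigma, Finset.sum_congr rfl (fun t ht => (hZ t ht).1)]
    · simp [hT]
    · rintro ⟨t, z⟩ h ⟨t', z'⟩ h' e
      simp only [Finset.coe_sigma, Set.mem_sigma_iff, Finset.mem_coe] at h h'
      simp only [Prod.mk.injEq] at e
      obtain ⟨e1, rfl⟩ := e
      have := mul_right_cancel₀ (hz0 t h.1 z h.2) e1
      subst this
      rfl
  have k2 : A2.card = 3 := by
    rw [Finset.card_image_of_injective, hΘ]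
    intro a b h
    exact (Prod.mk.inj h).2
  have k3 : ({(2,0),(1,2)} : Finset (K × K)).card = 2 := by
    apply Finset.card_pair
    intro h
    exact h22 (Prod.mk.inj h).2.symm
  have dis1 : Disjoint ({(2,0),(1,2)} : Finset (K × K)) A2 := by
    rw [Finset.disjoint_left]
    intro p hp hq
    have hq := (m2 p).mp hq
    simp only [Finset.mem_insert, Finset.mem_singleton] at hp
    rcases hp with rfl | rfl
    · have := hq.1
      grind
    · have := hq.1
      grind
  have dis2 : Disjoint A1 ({(2,0),(1,2)} ∪ A2) := by
    rw [Finset.disjoint_left]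
    intro p hp hq
    obtain ⟨h0, h1, h2⟩ := (m1 p).mp hp
    obtain ⟨x, z⟩ := p
    simp only at h0 h1 h2
    rw [Finset.mem_union, m2] at hq
    simp only [Finset.mem_insert, Finset.mem_singleton, Prod.mk.injEq] at hq
    have h2' : -z^3+z^2+3*z-1+(z+1)*x^2 = 0 := by
      obtain ⟨t, rfl⟩ : ∃ t, x = t * z := ⟨x / z, by field_simp⟩
      rw [mul_div_cancel_right₀ _ h0] at h2
      linear_combination h2
    rcases hq with (⟨rfl, rfl⟩ | ⟨rfl, rfl⟩) | ⟨a, rfl⟩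
    · exact h0 rfl
    · clear h1 h2
      grind
    · clear h1 h2
      grind
  refine ⟨A1 ∪ ({(2,0),(1,2)} ∪ A2), ?_, ?_⟩
  · rw [Finset.card_union_of_disjoint dis2, Finset.card_union_of_disjoint dis1, k1, k2, k3]
  · intro p
    rw [Finset.mem_union, Finset.mem_union, m1, m2, PA_iff]
    obtain ⟨x, z⟩ := p
    simp only [Finset.mem_insert, Finset.mem_singleton, Prod.mk.injEq]
    rw [or_assoc]

lemma card_mu [IsAlgClosed K] : ∃ M : Finset K, M.card = 7 ∧ ∀ ω, ω ∈ M ↔ ω^7 = 1 := by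
  have h7 : (7:K) ≠ 0 := by
    have := @c2 K _ _
    grind
  haveI : NeZero ((7:ℕ):K) := ⟨by exact_mod_cast h7⟩
  obtain ⟨ζ, hζ⟩ := HasEnoughRootsOfUnity.exists_primitiveRoot K 7
  refine ⟨Polynomial.nthRootsFinset 7 (1:K), hζ.card_nthRootsFinset, fun ω => ?_⟩
  rw [Polynomial.mem_nthRootsFinset (by norm_num)]

lemma pt_inj {ω x z ω' x' z' : K} (hω : ω^7 = 1) (hω' : ω'^7 = 1) (hx : x ≠ 0)
    (h : pt ω x z = pt ω' x' z') : ω = ω' ∧ x = x' ∧ z = z' := by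
  obtain ⟨e1, e2, e3, e4, e5⟩ := pt_rel ω x z hω
  obtain ⟨f1, f2, f3, f4, f5⟩ := pt_rel ω' x' z' hω'
  rw [h] at e1 e2 e3 e4
  have g1 : ω*x = ω'*x' := e1.symm.trans f1
  have g2 : x^2 = x'^2 := e3.symm.trans f3
  have g3 : x^7 = x'^7 := by
    have := congrArg (fun t => t^7) g1
    simpa only [mul_pow, hω, hω', one_mul] using this
  have g4 : x = x' := by
    apply mul_left_cancel₀ (pow_ne_zero 6 hx)
    have : x^6 = x'^6 := by linear_combination (x^4+x^2*x'^2+x'^4)*g2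
    calc x^6*x = x^7 := by ring
      _ = x'^6*x' := by rw [g3]; ring
      _ = x^6*x' := by rw [this]
  subst g4
  exact ⟨mul_right_cancel₀ hx g1, rfl, e4.symm.trans f4⟩

lemma mk_pt_inj {v v' : Fin 4 → K} (hv : v ≠ 0) (hv' : v' ≠ 0) (h3 : v 3 = 1) (h3' : v' 3 = 1)
    (h : Projectivization.mk K v hv = Projectivization.mk K v' hv') : v = v' := by
  rw [Projectivization.mk_eq_mk_iff'] at h
  obtain ⟨a, ha⟩ := h
  have := congrFun ha 3
  simp only [Pi.smul_apply, smul_eq_mul, h3, h3', mul_one] at this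
  rw [← ha, this, one_smul]

lemma node_all (p : Projectivization K (Fin 4 → K)) (hp : IsSingularPoint (S5 K) p) :
    p = Projectivization.mk K (ax1 K) ax1_ne ∨ p = Projectivization.mk K (ax2 K) ax2_ne ∨
    ∃ ω x z : K, ω^7 = 1 ∧ PA x z ∧ p = Projectivization.mk K (pt ω x z) (pt_ne ω x z) := by
  obtain ⟨v, hv, rfl, h⟩ := hp
  obtain ⟨c, hc, h⟩ := classify hv h
  have key : ∀ (u : Fin 4 → K) (hu : u ≠ 0), c • v = u →
      Projectivization.mk K v hv = Projectivization.mk K u hu := by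
    intro u hu e
    rw [Projectivization.mk_eq_mk_iff']
    exact ⟨c⁻¹, by rw [← e, smul_smul, inv_mul_cancel₀ hc, one_smul]⟩
  rcases h with h | h | ⟨ω, x, z, hω, hP, h⟩
  · exact Or.inl (key _ _ h)
  · exact Or.inr (Or.inl (key _ _ h))
  · exact Or.inr (Or.inr ⟨ω, x, z, hω, hP, key _ _ h⟩)

lemma main_S5 [IsAlgClosed K] :
    {p : Projectivization K (Fin 4 → K) | IsSingularPoint (S5 K) p}.ncard = 100 ∧
      ∀ p : Projectivization K (Fin 4 → K), IsSingularPoint (S5 K) p → IsNode (S5 K) p := by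
  classical
  constructor
  · obtain ⟨A, hA, hA'⟩ := card_PA (K := K)
    obtain ⟨M, hM, hM'⟩ := card_mu (K := K)
    let f : K × (K × K) → Projectivization K (Fin 4 → K) :=
      fun q => Projectivization.mk K (pt q.1 q.2.1 q.2.2) (pt_ne _ _ _)
    let P1 := Projectivization.mk K (ax1 K) ax1_ne
    let P2 := Projectivization.mk K (ax2 K) ax2_ne
    have hset : {p : Projectivization K (Fin 4 → K) | IsSingularPoint (S5 K) p} =
        (({P1, P2} ∪ (M ×ˢ A).image f : Finset _) : Set (Projectivization K (Fin 4 → K))) := by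
      ext p
      simp only [Set.mem_setOf_eq, Finset.mem_coe, Finset.mem_union, Finset.mem_insert,
        Finset.mem_singleton, Finset.mem_image, Finset.mem_product, hA', hM']
      constructor
      · intro hp
        rcases node_all p hp with h | h | ⟨ω, x, z, hω, hP, h⟩
        · exact Or.inl (Or.inl h)
        · exact Or.inl (Or.inr h)
        · exact Or.inr ⟨(ω, (x, z)), ⟨hω, hP⟩, h.symm⟩
      · rintro ((h | h) | ⟨q, ⟨hω, hP⟩, h⟩)
        · exact ⟨_, ax1_ne, h.symm, sing_ax1⟩
        · exact ⟨_, ax2_ne, h.symm, sing_ax2⟩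
        · exact ⟨_, pt_ne _ _ _, h, sing_pt hω hP⟩
    rw [hset, Set.ncard_coe_finset, Finset.card_union_of_disjoint, Finset.card_pair,
      Finset.card_image_of_injOn, Finset.card_product, hA, hM]
    · rintro ⟨ω, x, z⟩ h ⟨ω', x', z'⟩ h' e
      simp only [Finset.coe_product, Set.mem_prod, Finset.mem_coe, hA', hM'] at h h'
      have e' := mk_pt_inj _ _ rfl rfl e
      obtain ⟨rfl, rfl, rfl⟩ := pt_inj h.1 h'.1 h.2.1 e'
      rfl
    · intro e
      rw [Projectivization.mk_eq_mk_iff'] at e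
      obtain ⟨a, ha⟩ := e
      have a3 := congrFun ha 3
      have a2 := congrFun ha 2
      simp [ax1, ax2] at a3 a2
      simp [a3] at a2
    · rw [Finset.disjoint_left]
      intro p hp hq
      simp only [Finset.mem_insert, Finset.mem_singleton, Finset.mem_image, Finset.mem_product,
        hA', hM'] at hp hq
      obtain ⟨⟨ω, x, z⟩, ⟨hω, hP⟩, e⟩ := hq
      rcases hp with h | h
      · have e2 := e.trans h
        rw [Projectivization.mk_eq_mk_iff'] at e2
        obtain ⟨a, ha⟩ := e2
        have a3 := congrFun ha 3
        simp [ax1, pt] at a3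
      · have e2 := mk_pt_inj _ _ rfl rfl (e.trans h)
        have r1 := (pt_rel ω x z hω).2.2.1
        simp only at e2
        rw [e2] at r1
        simp [ax2] at r1
        exact hP.1 ((pow_eq_zero_iff (two_ne_zero)).mp r1.symm)
  · intro p hp
    rcases node_all p hp with h | h | ⟨ω, x, z, hω, hP, h⟩
    · exact ⟨_, ax1_ne, h.symm, sing_ax1, hess_ax1⟩
    · exact ⟨_, ax2_ne, h.symm, sing_ax2, hess_ax2⟩
    · exact ⟨_, pt_ne _ _ _, h.symm, sing_pt hω hP, hess_pt hω hP⟩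

end gen


/-- Over an algebraic closure K of 𝔽₅, with α := 1 (which satisfies
7α³ + 7α + 1 = 0 in K) and the parameters of the theorem (fractions interpreted
via the inverses of 7 and 49 in K), the surface {S_α = 0} in ℙ³(K) has exactly
100 singular points, all of which are nodes. -/
theorem septic_100_nodes_char5
    (α : K5) (hα : α = 1)
    (a₁ a₂ a₃ a₄ a₅ : K5)
    (ha₁ : a₁ = -(12 / 7) * α ^ 2 - (384 / 49) * α - 8 / 7)
    (ha₂ : a₂ = -(32 / 7) * α ^ 2 + (24 / 49) * α - 4)
    (ha₃ : a₃ = -4 * α ^ 2 + (24 / 49) * α - 4)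
    (ha₄ : a₄ = -(8 / 7) * α ^ 2 + (8 / 49) * α - 8 / 7)
    (ha₅ : a₅ = 49 * α ^ 2 - 7 * α + 50)
    (S : MvPolynomial (Fin 4) K5) (hS : S = Psept K5 - Usept a₁ a₂ a₃ a₄ a₅) :
    7 * α ^ 3 + 7 * α + 1 = 0 ∧
      {p : Projectivization K5 (Fin 4 → K5) | IsSingularPoint S p}.ncard = 100 ∧
      ∀ p : Projectivization K5 (Fin 4 → K5),
        IsSingularPoint S p → IsNode S p := by

  haveI : CharP K5 5 := inferInstance
  have h55 : (5:K5) = 0 := by exact_mod_cast CharP.cast_eq_zero K5 5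
  have h7 : (7:K5) = 2 := by linear_combination h55
  have h49 : (49:K5) = -1 := by linear_combination 10 * h55
  have h22 : (2:K5) ≠ 0 := c2
  subst hα
  have hi : (2:K5)⁻¹ = 3 := by
    rw [inv_eq_iff_eq_inv]
    apply eq_inv_of_mul_eq_one_left
    linear_combination h55
  have b1 : a₁ = -1 := by
    rw [ha₁, h7, h49]
    simp only [div_eq_mul_inv, hi, inv_neg, inv_one]
    grind
  have b2 : a₂ = 1 := by
    rw [ha₂, h7, h49]
    simp only [div_eq_mul_inv, hi, inv_neg, inv_one]
    grind
  have b3 : a₃ = 3 := by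
    rw [ha₃, h49]
    simp only [div_eq_mul_inv, inv_neg, inv_one]
    grind
  have b4 : a₄ = -1 := by
    rw [ha₄, h7, h49]
    simp only [div_eq_mul_inv, hi, inv_neg, inv_one]
    grind
  have b5 : a₅ = 2 := by
    rw [ha₅]
    grind
  have hS5 : S = S5 K5 := by
    rw [hS, b1, b2, b3, b4, b5]
    rfl
  rw [hS5]
  refine ⟨by grind, main_S5⟩
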